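/- In the construction of Theorem 4, let S be a selection of the partition and let c : S → {green, red} be a proper 2-coloring of G[S] with c(g) = green and c(r) = red. Then for every clause index t ∈ {1,...,m}, at least one of the three literal-layer vertices l^t_1, l^t_2, l^t_3 (all of which necessarily belong to S) is assigned the color green by c. -/

import Mathlib

/-- Vertices of the graph constructed in Theorem 4 from a 3-SAT formula with
`m` clauses: the two special vertices `g` and `r`, and for each clause `t` and
each position `i ∈ {1,2,3}` a literal-layer vertex `lit t i`, a middle-layer
vertex `mid t i` and a conflict-layer vertex `con t i` (in total `9m+2`
vertices). -/
inductive PCPVert (m : ℕ) : Type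
  | g : PCPVert m
  | r : PCPVert m
  | lit : Fin m → Fin 3 → PCPVert m
  | mid : Fin m → Fin 3 → PCPVert m
  | con : Fin m → Fin 3 → PCPVert m
deriving DecidableEq

/-- The base (pre-symmetrization) edge relation of the construction of
Theorem 4, where the 3-SAT formula is given by `a : Fin m → Fin 3 → Fin n × Bool`
(clause `t` has literals `a t 0, a t 1, a t 2`; a literal is a variable index
together with a sign, `true` for a positive literal `x` and `false` for `¬x`):
the edge (g,r); the edges (lit t i, mid t i); the edges (mid t i, g); the
triangle on the conflict layer of each clause; and an edge between any two
literal-layer vertices carrying contrary literals. -/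
def pcpRel {m n : ℕ} (a : Fin m → Fin 3 → Fin n × Bool) :
    PCPVert m → PCPVert m → Prop
  | .g, .r => True
  | .lit t i, .mid t' i' => t = t' ∧ i = i'
  | .mid _ _, .g => True
  | .con t _, .con t' _ => t = t'
  | .lit t i, .lit t' i' => (a t i).1 = (a t' i').1 ∧ (a t i).2 = !(a t' i').2
  | _, _ => False

/-- Property 1 in the proof of Theorem 4: for any selection `S` of the
partition (the parts being `{g}`, `{r}`, the singletons `{lit t i}` and the
pairs `{mid t i, con t i}`) and any proper 2-coloring `c` of the induced
subgraph on `S` with `c g = green` (color `0`) and `c r = red` (color `1`),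
every clause `t` has at least one literal-layer vertex `lit t i` colored
green. -/
theorem pcp_q2_k2_one_green_per_clause {m n : ℕ}
    (a : Fin m → Fin 3 → Fin n × Bool)
    (S : Set (PCPVert m))
    (hgS : PCPVert.g ∈ S) (hrS : PCPVert.r ∈ S)
    (hlitS : ∀ t i, PCPVert.lit t i ∈ S)
    (hmcS : ∀ t i, (PCPVert.mid t i ∈ S ↔ PCPVert.con t i ∉ S))
    (c : ((SimpleGraph.fromRel (pcpRel a)).induce S).Coloring (Fin 2))
    (hg : c ⟨PCPVert.g, hgS⟩ = 0) (hr : c ⟨PCPVert.r, hrS⟩ = 1) :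
    ∀ t : Fin m, ∃ i : Fin 3, c ⟨PCPVert.lit t i, hlitS t i⟩ = 0 := by
  intro t
  by_contra! hred
  have hcon : ∀ i, PCPVert.con t i ∈ S := by
    intro i
    by_contra hi
    have hmid := (hmcS t i).2 hi
    have hlm : c ⟨PCPVert.lit t i, hlitS t i⟩ ≠ c ⟨PCPVert.mid t i, hmid⟩ :=
      c.valid (by simp [pcpRel])
    have hmg : c ⟨PCPVert.mid t i, hmid⟩ ≠ c ⟨PCPVert.g, hgS⟩ :=
      c.valid (by simp [pcpRel])
    have := hred i
    omega
  have hne : ∀ i j, i ≠ j → c ⟨PCPVert.con t i, hcon i⟩ ≠ c ⟨PCPVert.con t j, hcon j⟩ :=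
    fun i j hij => c.valid (by simp [pcpRel, hij])
  have h01 := hne 0 1 (by decide)
  have h02 := hne 0 2 (by decide)
  have h12 := hne 1 2 (by decide)
  omega
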